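/- Let u ∈ F_2 be cyclically reduced. If the reduced word of x_1 x_2 x_1⁻¹ x_2⁻¹ x_1 occurs as a contiguous subword (infix) of the reduced word of u, then u is not potentially positive. -/

import Mathlib

/-- `FG r` is the free group `F_r` of rank `r`, with free generating set
`x_1, …, x_r` given by `FreeGroup.of 0, …, FreeGroup.of (r-1)`. -/
abbrev FG (r : ℕ) := FreeGroup (Fin r)

/-- `|w|`, the length of the reduced word representing `w`. -/
def wordLength {r : ℕ} (w : FG r) : ℕ := w.toWord.length

/-- `w` is cyclically reduced: its reduced word is empty, or its first letter is not
the inverse of its last letter.  (A letter `(i, b)` has inverse `(i, !b)`.) -/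
def CyclicallyReduced {r : ℕ} (w : FG r) : Prop :=
  ∀ a ∈ w.toWord.head?, ∀ b ∈ w.toWord.getLast?, a ≠ (b.1, !b.2)

/-- `p` is a primitive element of `F_r`: the image of `x_1` under some automorphism. -/
def Primitive {r : ℕ} (hr : 0 < r) (p : FG r) : Prop :=
  ∃ φ : FG r ≃* FG r, φ (FreeGroup.of ⟨0, hr⟩) = p

/-- `v` is primitivity-blocking: the reduced word of `v` is not an infix of the reduced
word of any cyclically reduced primitive element of `F_r`. -/
def PrimitivityBlocking {r : ℕ} (hr : 0 < r) (v : FG r) : Prop :=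
  ∀ p : FG r, Primitive hr p → CyclicallyReduced p → ¬ v.toWord <:+: p.toWord

/-- `v` is `w`-orbit-blocking: for every automorphism `φ` with `φ w` cyclically reduced,
the reduced word of `v` is not an infix of the reduced word of `φ w`. -/
def OrbitBlocking {r : ℕ} (w v : FG r) : Prop :=
  ∀ φ : FG r ≃* FG r, CyclicallyReduced (φ w) → ¬ v.toWord <:+: (φ w).toWord

/-- `u` is positive: every letter of its reduced word is a generator (not an inverse). -/
def Positive {r : ℕ} (u : FG r) : Prop := ∀ l ∈ u.toWord, l.2 = true

/-- The cyclic length `‖u‖`: the minimum of `|g u g⁻¹|` over all `g`. -/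
noncomputable def cyclicLength {r : ℕ} (u : FG r) : ℕ :=
  sInf (Set.range fun g : FG r => wordLength (g * u * g⁻¹))

/-- `gen r j` is the generator `x_{j+1}` of `F_r` (0-indexed: the `j`-th generator),
for `j < r`. -/
def gen (r : ℕ) (j : ℕ) : FG r :=
  if h : j < r then FreeGroup.of ⟨j, h⟩ else 1

/-- `(b_1, …, b_r)` is a basis of `F_r`: some automorphism sends `x_i` to `b_i`. -/
def IsBasis {r : ℕ} (b : Fin r → FG r) : Prop :=
  ∃ φ : FG r ≃* FG r, ∀ i, φ (FreeGroup.of i) = b i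

namespace FreeGroup

section GromovProduct

variable {α : Type*} [DecidableEq α]

theorem IsReduced.invRev {L : List (α × Bool)} (h : IsReduced L) :
    IsReduced (FreeGroup.invRev L) := by
  rw [isReduced_iff_reduce_eq] at h ⊢
  rw [reduce_invRev, h]

theorem IsReduced.exists_common_prefix {L₁ L₂ : List (α × Bool)} (h₁ : IsReduced L₁)
    (h₂ : IsReduced L₂) : ∃ c M N, L₁ = c ++ M ∧ L₂ = c ++ N ∧
      IsReduced (FreeGroup.invRev M ++ N) := by
  induction L₁ generalizing L₂ with
  | nil => exact ⟨[], [], L₂, rfl, rfl, by simpa using h₂⟩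
  | cons x L₁ ih =>
    cases L₂ with
    | nil => exact ⟨[], x :: L₁, [], rfl, rfl, by simpa using h₁.invRev⟩
    | cons y L₂ =>
      by_cases hxy : x = y
      · subst hxy
        obtain ⟨c, M, N, h, h', hr⟩ := ih h₁.tail h₂.tail
        exact ⟨x :: c, M, N, by simp [h], by simpa using h', hr⟩
      · refine ⟨[], x :: L₁, y :: L₂, rfl, rfl, ?_⟩
        refine List.IsChain.append h₁.invRev h₂ ?_
        rintro a ha b hb h
        obtain ⟨x, s⟩ := x
        obtain ⟨y, t⟩ := y
        simp only [FreeGroup.invRev, List.map_cons, List.reverse_cons, List.getLast?_append,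
          List.getLast?_singleton, Option.some_or, Option.mem_def, Option.some.injEq,
          List.head?_cons] at ha hb
        subst ha hb
        cases s <;> cases t <;> simp_all

/-- The length of the longest common prefix of the reduced words of `x` and `y`. -/
def gromovProduct (x y : FreeGroup α) : ℕ := (norm x + norm y - norm (x⁻¹ * y)) / 2

theorem norm_mk_of_isReduced {L : List (α × Bool)} (h : IsReduced L) :
    norm (mk L) = L.length := by
  rw [norm, toWord_mk, h.reduce_eq]

theorem norm_inv_mul_add_two_mul_length_le {x y : FreeGroup α} {c M N : List (α × Bool)}
    (hx : x.toWord = c ++ M) (hy : y.toWord = c ++ N) :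
    norm (x⁻¹ * y) + 2 * c.length ≤ norm x + norm y := by
  have hx' : x = mk c * mk M := by rw [← mk_toWord (x := x), hx, mul_mk]
  have hy' : y = mk c * mk N := by rw [← mk_toWord (x := y), hy, mul_mk]
  have h : x⁻¹ * y = (mk M)⁻¹ * mk N := by rw [hx', hy']; group
  have h₁ := norm_mul_le (mk M)⁻¹ (mk N)
  have h₂ := norm_mk_le (L₁ := M)
  have h₃ := norm_mk_le (L₁ := N)
  rw [norm_inv_eq] at h₁
  rw [h, norm, norm, norm, hx, hy, List.length_append, List.length_append]
  rw [norm] at h₁ h₂ h₃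
  rw [norm, norm] at h₁
  omega

theorem exists_common_prefix_toWord (x y : FreeGroup α) :
    ∃ c M N, x.toWord = c ++ M ∧ y.toWord = c ++ N ∧
      norm (x⁻¹ * y) + 2 * c.length = norm x + norm y := by
  obtain ⟨c, M, N, hx, hy, hr⟩ :=
    IsReduced.exists_common_prefix (isReduced_toWord (x := x)) (isReduced_toWord (x := y))
  refine ⟨c, M, N, hx, hy, ?_⟩
  have hx' : x = mk c * mk M := by rw [← mk_toWord (x := x), hx, mul_mk]
  have hy' : y = mk c * mk N := by rw [← mk_toWord (x := y), hy, mul_mk]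
  have h : x⁻¹ * y = mk (FreeGroup.invRev M ++ N) := by
    rw [← mul_mk, ← inv_mk, hx', hy']; group
  rw [h, norm_mk_of_isReduced hr, norm, norm, hx, hy]
  simp only [List.length_append, invRev_length]
  omega

theorem norm_inv_mul_add_two_mul_gromovProduct (x y : FreeGroup α) :
    norm (x⁻¹ * y) + 2 * gromovProduct x y = norm x + norm y := by
  obtain ⟨c, M, N, -, -, h⟩ := exists_common_prefix_toWord x y
  rw [gromovProduct]
  omega

theorem exists_prefix_length_eq_gromovProduct (x y : FreeGroup α) :
    ∃ c, c <+: x.toWord ∧ c <+: y.toWord ∧ c.length = gromovProduct x y := by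
  obtain ⟨c, M, N, hx, hy, h⟩ := exists_common_prefix_toWord x y
  refine ⟨c, ⟨M, hx.symm⟩, ⟨N, hy.symm⟩, ?_⟩
  rw [gromovProduct]
  omega

theorem length_le_gromovProduct {x y : FreeGroup α} {c : List (α × Bool)}
    (hx : c <+: x.toWord) (hy : c <+: y.toWord) : c.length ≤ gromovProduct x y := by
  obtain ⟨M, hM⟩ := hx
  obtain ⟨N, hN⟩ := hy
  have := norm_inv_mul_add_two_mul_length_le hM.symm hN.symm
  rw [gromovProduct]
  omega

theorem min_gromovProduct_le (x y z : FreeGroup α) :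
    min (gromovProduct x y) (gromovProduct y z) ≤ gromovProduct x z := by
  obtain ⟨c, hcx, hcy, hc⟩ := exists_prefix_length_eq_gromovProduct x y
  obtain ⟨d, hdy, hdz, hd⟩ := exists_prefix_length_eq_gromovProduct y z
  rcases le_total c.length d.length with h | h
  · exact (min_le_left _ _).trans
      (hc ▸ length_le_gromovProduct hcx ((List.prefix_of_prefix_length_le hcy hdy h).trans hdz))
  · exact (min_le_right _ _).trans
      (hd ▸ length_le_gromovProduct ((List.prefix_of_prefix_length_le hdy hcy h).trans hcx) hdz)

theorem gromovProduct_comm (x y : FreeGroup α) : gromovProduct x y = gromovProduct y x := by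
  have h : (x⁻¹ * y)⁻¹ = y⁻¹ * x := by group
  rw [gromovProduct, gromovProduct, ← h, norm_inv_eq, add_comm (norm x)]

theorem two_mul_gromovProduct_inv_lt {x : FreeGroup α} (hx : x ≠ 1) :
    2 * gromovProduct x⁻¹ x < norm x := by
  have key := norm_inv_mul_add_two_mul_gromovProduct x⁻¹ x
  rw [inv_inv, norm_inv_eq] at key
  have h₁ := reduceCyclically.conj_conjugator_reduceCyclically x.toWord
  have h₂ := reduceCyclically.reduce_flatten_replicate_succ (isReduced_toWord (x := x)) 1
  have h₃ : norm (x * x) = (reduce (List.replicate 2 x.toWord).flatten).length := by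
    rw [norm, toWord_mul]; simp [List.replicate]
  have h₄ := congrArg List.length h₁
  have h₅ := congrArg List.length h₂
  simp [List.replicate] at h₃ h₄ h₅
  have h₆ : (reduceCyclically x.toWord).length ≠ 0 := by
    intro h0
    rw [List.length_eq_zero_iff] at h0
    apply hx
    rw [← mk_toWord (x := x), ← h₁, h0]
    simp [← mul_mk, ← inv_mk]
  have h₇ : norm x = x.toWord.length := rfl
  omega

end GromovProduct

section NielsenReduced

variable {α β : Type*} [DecidableEq α]

/-- A family of elements of a free group is Nielsen reduced if in every reduced product of its
members and their inverses, the parts of a factor cancelled from the left and from the right do not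
exhaust that factor. -/
def IsNielsenReduced (f : β → FreeGroup α) : Prop :=
  ∀ l m n : β × Bool, l ≠ (m.1, !m.2) → m ≠ (n.1, !n.2) →
    gromovProduct (lift f (mk [l]))⁻¹ (lift f (mk [m])) +
      gromovProduct (lift f (mk [m]))⁻¹ (lift f (mk [n])) < norm (lift f (mk [m]))

theorem IsNielsenReduced.gromovProduct_le_and_le_norm {f : β → FreeGroup α}
    (hf : IsNielsenReduced f) {w : List (β × Bool)} {n : β × Bool} (hw : IsReduced (n :: w))
    {m : β × Bool} (hm : m ≠ (n.1, !n.2)) :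
    gromovProduct (lift f (mk [m]))⁻¹ (lift f (mk (n :: w))) ≤
        gromovProduct (lift f (mk [m]))⁻¹ (lift f (mk [n])) ∧
      gromovProduct (lift f (mk [m]))⁻¹ (lift f (mk [n])) + (n :: w).length ≤
        norm (lift f (mk (n :: w))) := by
  induction w generalizing n m with
  | nil =>
    refine ⟨le_rfl, ?_⟩
    have := hf m n n hm (fun h => by simpa using congrArg Prod.snd h)
    simp only [List.length_singleton]
    omega
  | cons k w ih =>
    have hnk : n ≠ (k.1, !k.2) := by
      rintro rfl
      simpa using (isReduced_cons_cons.1 hw).1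
    obtain ⟨h₁, h₂⟩ := ih hw.tail hnk
    have hprod : lift f (mk (n :: k :: w)) = lift f (mk [n]) * lift f (mk (k :: w)) := by
      rw [← _root_.map_mul, mul_mk, List.singleton_append]
    have h₃ := hf m n k hm hnk
    rw [hprod]
    generalize lift f (mk (k :: w)) = e at *
    generalize lift f (mk [n]) = x at *
    generalize lift f (mk [m]) = y at *
    generalize lift f (mk [k]) = z at *
    have h₄ := norm_inv_mul_add_two_mul_gromovProduct x⁻¹ e
    have h₅ := norm_inv_mul_add_two_mul_gromovProduct x (x * e)
    have h₆ := min_gromovProduct_le y⁻¹ (x * e) x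
    rw [inv_inv, norm_inv_eq] at h₄
    rw [inv_mul_cancel_left] at h₅
    rw [gromovProduct_comm (x * e) x] at h₆
    simp only [List.length_cons] at h₂ ⊢
    omega

theorem IsNielsenReduced.norm_le_norm_lift [DecidableEq β] {f : β → FreeGroup α}
    (hf : IsNielsenReduced f) (w : FreeGroup β) : norm w ≤ norm (lift f w) := by
  rcases hw : w.toWord with _ | ⟨n, L⟩
  · rw [toWord_eq_nil_iff] at hw
    simp [hw]
  · have hred : IsReduced (n :: L) := hw ▸ isReduced_toWord
    have h := (hf.gromovProduct_le_and_le_norm hred (m := n)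
      (fun h => by simpa using congrArg Prod.snd h)).2
    rw [← hw, mk_toWord] at h
    exact (Nat.le_add_left _ _).trans h

end NielsenReduced

/-- The elements `p` and `q` generate the group `G`. -/
def PairGenerates {G : Type*} [Group G] (p q : G) : Prop :=
  ∀ H : Subgroup G, p ∈ H → q ∈ H → H = ⊤

namespace PairGenerates

variable {G : Type*} [Group G] {p q : G}

theorem swap (h : PairGenerates p q) : PairGenerates q p := fun H hq hp => h H hp hq

theorem inv_left (h : PairGenerates p q) : PairGenerates p⁻¹ q :=
  fun H hp hq => h H (by simpa using hp) hq

theorem inv_right (h : PairGenerates p q) : PairGenerates p q⁻¹ := h.swap.inv_left.swap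

theorem mul_left (h : PairGenerates p q) : PairGenerates (p * q) q :=
  fun H hp hq => h H ((Subgroup.mul_mem_cancel_right H hq).1 hp) hq

theorem mul_right (h : PairGenerates p q) : PairGenerates p (p * q) :=
  fun H hp hq => h H hp ((Subgroup.mul_mem_cancel_left H hp).1 hq)

theorem conj (h : PairGenerates p q) (g : G) :
    PairGenerates (g * p * g⁻¹) (g * q * g⁻¹) := by
  intro H hp hq
  have hH := h (H.comap (MulAut.conj g).toMonoidHom) (by simpa using hp) (by simpa using hq)
  rw [Subgroup.eq_top_iff'] at hH ⊢
  intro x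
  simpa [mul_assoc] using hH (g⁻¹ * x * g)

theorem left_ne_one {p q : FreeGroup (Fin 2)} (h : PairGenerates p q) : p ≠ 1 := by
  rintro rfl
  have hH := h (Subgroup.zpowers q) (one_mem _) (Subgroup.mem_zpowers q)
  rw [Subgroup.eq_top_iff'] at hH
  obtain ⟨m, hm⟩ := hH (of 0)
  obtain ⟨n, hn⟩ := hH (of 1)
  simp only at hm hn
  have hc : (of 0 * of 1 : FreeGroup (Fin 2)) = of 1 * of 0 := by
    rw [← hm, ← hn, ← zpow_add, ← zpow_add, add_comm]
  revert hc
  decide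

end PairGenerates

/-- A property of pairs of elements of a free group that is invariant under conjugation and under
the elementary Nielsen transformations. -/
structure NielsenInvariant {G : Type*} [Group G] (C : G → G → Prop) : Prop where
  conj : ∀ (g : G) {p q}, C p q → C (g * p * g⁻¹) (g * q * g⁻¹)
  swap : ∀ {p q}, C p q → C q p
  inv_left : ∀ {p q}, C p q → C p⁻¹ q
  mul_left : ∀ {p q}, C p q → C (p * q) q

namespace NielsenInvariant

section Group

variable {G : Type*} [Group G] {C : G → G → Prop} {p q : G}

theorem inv_right (hC : NielsenInvariant C) (h : C p q) : C p q⁻¹ :=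
  hC.swap (hC.inv_left (hC.swap h))

theorem of_inv_left (hC : NielsenInvariant C) (h : C p⁻¹ q) : C p q := by simpa using hC.inv_left h

theorem of_inv_right (hC : NielsenInvariant C) (h : C p q⁻¹) : C p q := by simpa using hC.inv_right h

theorem of_mul_left (hC : NielsenInvariant C) (h : C (p * q) q) : C p q := by
  simpa using hC.inv_right (hC.mul_left (hC.inv_right h))

theorem of_mul_right (hC : NielsenInvariant C) (h : C p (p * q)) : C p q := by
  have h₁ := hC.mul_left (hC.inv_left (hC.swap h))
  rw [mul_inv_rev, inv_mul_cancel_right] at h₁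
  exact hC.of_inv_right (hC.swap h₁)

end Group

end NielsenInvariant

theorem exists_mk_of_two_mul_gromovProduct_eq {α : Type*} [DecidableEq α] {x y : FreeGroup α}
    (hxy : norm x ≤ norm y) (h₁ : 2 * gromovProduct x y = norm x)
    (h₂ : 2 * gromovProduct x⁻¹ y⁻¹ = norm x) :
    ∃ s r t : List (α × Bool), x = mk s * mk t ∧ y = mk s * mk r * mk t ∧
      norm x = s.length + t.length ∧ norm y = s.length + r.length + t.length := by
  obtain ⟨s, ⟨t, hst⟩, ⟨y', hy'⟩, hs⟩ := exists_prefix_length_eq_gromovProduct x y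
  obtain ⟨c, ⟨M, hM⟩, ⟨N, hN⟩, hc⟩ := exists_prefix_length_eq_gromovProduct x⁻¹ y⁻¹
  have hM' : x.toWord = invRev M ++ invRev c := by
    rw [← invRev_append, hM, toWord_inv, invRev_invRev]
  have hN' : y.toWord = invRev N ++ invRev c := by
    rw [← invRev_append, hN, toWord_inv, invRev_invRev]
  have hx : norm x = x.toWord.length := rfl
  have hy : norm y = y.toWord.length := rfl
  have lx := congrArg List.length hst
  have ly := congrArg List.length hy'
  rw [List.length_append] at lx ly
  have ht : t = invRev c := by
    refine (List.append_inj_right' (hst.trans hM') ?_)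
    rw [invRev_length]
    omega
  have hsuf : t <:+ y' := by
    refine List.suffix_of_suffix_length_le (l₃ := y.toWord) ⟨invRev N, ?_⟩ ⟨s, hy'⟩ (by omega)
    rw [ht, hN']
  obtain ⟨r, hr⟩ := hsuf
  refine ⟨s, r, t, ?_, ?_, by omega, ?_⟩
  · rw [mul_mk, hst, mk_toWord]
  · rw [mul_mk, mul_mk, List.append_assoc, hr, hy', mk_toWord]
  · rw [hy, ← hy', ← hr, List.length_append, List.length_append, add_assoc]

theorem NielsenInvariant.le_norm_of_minimal {C : FreeGroup (Fin 2) → FreeGroup (Fin 2) → Prop}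
    (hC : NielsenInvariant C) {x y : FreeGroup (Fin 2)} (hg : PairGenerates x y)
    (ih : ∀ p q, PairGenerates p q → norm p + norm q < norm x + norm y → C p q)
    (hxy : ¬ C x y) : norm x ≤ norm (x * y) ∧ norm y ≤ norm (x * y) := by
  constructor
  · by_contra! h
    exact hxy (hC.of_mul_left (ih _ _ hg.mul_left (by omega)))
  · by_contra! h
    exact hxy (hC.of_mul_right (ih _ _ hg.mul_right (by omega)))

theorem NielsenInvariant.two_mul_gromovProduct_ne {C : FreeGroup (Fin 2) → FreeGroup (Fin 2) → Prop}
    (hC : NielsenInvariant C) {x y : FreeGroup (Fin 2)} (hg : PairGenerates x y)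
    (ih : ∀ p q, PairGenerates p q → norm p + norm q < norm x + norm y → C p q)
    (hxy : ¬ C x y) (hle : norm x ≤ norm y) (h₁ : 2 * gromovProduct x y = norm x) :
    2 * gromovProduct x⁻¹ y⁻¹ ≠ norm x := by
  intro h₂
  have hx := norm_eq_zero.not.2 hg.left_ne_one
  obtain ⟨s, r, t, rfl, rfl, hs, hr⟩ := exists_mk_of_two_mul_gromovProduct_eq hle h₁ h₂
  have hg' : PairGenerates (FreeGroup.mk t * FreeGroup.mk s) (FreeGroup.mk r) := by
    refine fun H hp hq => hg.conj (FreeGroup.mk t) H ?_ ?_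
    · simpa only [mul_assoc, mul_inv_cancel, mul_one] using hp
    · simpa only [mul_assoc, mul_inv_cancel, mul_one] using mul_mem hp hq
  have hn : norm (FreeGroup.mk t * FreeGroup.mk s) ≤ t.length + s.length :=
    (norm_mul_le _ _).trans (add_le_add norm_mk_le norm_mk_le)
  have hn' : norm (FreeGroup.mk r) ≤ r.length := norm_mk_le
  have h := hC.conj (FreeGroup.mk t)⁻¹ (ih _ _ hg' (by omega))
  apply hxy
  have hs : FreeGroup.mk s * FreeGroup.mk t =
      (FreeGroup.mk t)⁻¹ * (FreeGroup.mk t * FreeGroup.mk s) * (FreeGroup.mk t)⁻¹⁻¹ := by group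
  have hr : FreeGroup.mk s * FreeGroup.mk r * FreeGroup.mk t =
      (FreeGroup.mk s * FreeGroup.mk t) * ((FreeGroup.mk t)⁻¹ * FreeGroup.mk r * (FreeGroup.mk t)⁻¹⁻¹) := by group
  rw [hr]
  refine hC.of_inv_left (hC.of_mul_right ?_)
  rw [inv_mul_cancel_left]
  apply hC.inv_left
  rwa [hs]

theorem isNielsenReduced_pair {p q : FreeGroup (Fin 2)} (hp : p ≠ 1) (hq : q ≠ 1)
    (hle : ∀ x y, (x = p ∨ x = p⁻¹) → (y = q ∨ y = q⁻¹) →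
      2 * gromovProduct x y ≤ norm p ∧ 2 * gromovProduct x y ≤ norm q)
    (hne : ∀ x y, (x = p ∨ x = p⁻¹) → (y = q ∨ y = q⁻¹) →
      (2 * gromovProduct x y = norm p → 2 * gromovProduct x⁻¹ y⁻¹ ≠ norm p) ∧
      (2 * gromovProduct x y = norm q → 2 * gromovProduct x⁻¹ y⁻¹ ≠ norm q)) :
    IsNielsenReduced ![p, q] := by
  have a₁ := hle p q (.inl rfl) (.inl rfl)
  have a₂ := hle p⁻¹ q (.inr rfl) (.inl rfl)
  have a₃ := hle p q⁻¹ (.inl rfl) (.inr rfl)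
  have a₄ := hle p⁻¹ q⁻¹ (.inr rfl) (.inr rfl)
  have b₁ := hne p q (.inl rfl) (.inl rfl)
  have b₃ := hne p q⁻¹ (.inl rfl) (.inr rfl)
  have c₁ := two_mul_gromovProduct_inv_lt hp
  have c₂ := two_mul_gromovProduct_inv_lt hq
  have d₁ := min_gromovProduct_le p q p⁻¹
  have d₂ := min_gromovProduct_le p q⁻¹ p⁻¹
  have d₃ := min_gromovProduct_le q p q⁻¹
  have d₄ := min_gromovProduct_le q p⁻¹ q⁻¹
  rw [inv_inv] at b₃
  rw [gromovProduct_comm p⁻¹ p] at c₁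
  rw [gromovProduct_comm q⁻¹ q] at c₂
  rw [gromovProduct_comm q p⁻¹] at d₁
  rw [gromovProduct_comm q⁻¹ p⁻¹] at d₂
  rw [gromovProduct_comm q p] at d₃
  rw [gromovProduct_comm q p⁻¹] at d₄
  have e₁ := gromovProduct_comm p⁻¹ p
  have e₂ := gromovProduct_comm q⁻¹ q
  have e₃ := gromovProduct_comm q p
  have e₄ := gromovProduct_comm q p⁻¹
  have e₅ := gromovProduct_comm q⁻¹ p
  have e₆ := gromovProduct_comm q⁻¹ p⁻¹
  rintro ⟨l, bl⟩ ⟨m, bm⟩ ⟨n, bn⟩ hlm hmn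
  fin_cases l <;> fin_cases m <;> fin_cases n <;> cases bl <;> cases bm <;> cases bn <;>
    first
    | exact absurd rfl hlm
    | exact absurd rfl hmn
    | (simp [norm_inv_eq, -ne_eq]; omega)

theorem NielsenInvariant.of_isNielsenReduced {C : FreeGroup (Fin 2) → FreeGroup (Fin 2) → Prop}
    (hC : NielsenInvariant C) (hbase : C (of 0) (of 1)) {p q : FreeGroup (Fin 2)}
    (hg : PairGenerates p q) (hr : IsNielsenReduced ![p, q]) : C p q := by
  have hsurj : ∀ x : FreeGroup (Fin 2), norm x = 1 → ∃ l, lift ![p, q] (FreeGroup.mk [l]) = x := by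
    intro x hx
    have hH := hg (lift ![p, q]).range ⟨of 0, by simp⟩ ⟨of 1, by simp⟩
    obtain ⟨w, rfl⟩ : x ∈ (lift ![p, q]).range := hH ▸ Subgroup.mem_top x
    have hw := hr.norm_le_norm_lift w
    have hw' : norm w ≠ 0 := by
      rw [Ne, norm_eq_zero]
      rintro rfl
      simp at hx
    obtain ⟨l, hl⟩ := List.length_eq_one_iff.1 (show w.toWord.length = 1 by rw [norm] at hw hw'; omega)
    exact ⟨l, by rw [← hl, mk_toWord]⟩
  obtain ⟨⟨l, s⟩, h₀⟩ := hsurj (of 0) (norm_of 0)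
  obtain ⟨⟨m, t⟩, h₁⟩ := hsurj (of 1) (norm_of 1)
  have n₁ : (of 0 : FreeGroup (Fin 2)) ≠ of 1 := by decide
  have n₂ : (of 0 : FreeGroup (Fin 2)) ≠ (of 1)⁻¹ := by decide
  have n₃ : (of 0 : FreeGroup (Fin 2))⁻¹ ≠ (of 1) := by decide
  rw [← h₀, ← h₁] at hbase n₁ n₂ n₃
  fin_cases l <;> fin_cases m <;> cases s <;> cases t <;> simp at hbase n₁ n₂ n₃
  · exact hC.of_inv_left (hC.of_inv_right hbase)
  · exact hC.of_inv_left hbase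
  · exact hC.of_inv_right hbase
  · exact hbase
  · exact hC.swap (hC.of_inv_left (hC.of_inv_right hbase))
  · exact hC.swap (hC.of_inv_left hbase)
  · exact hC.swap (hC.of_inv_right hbase)
  · exact hC.swap hbase

/-- Nielsen's theorem in rank two: every generating pair arises from the standard basis by
elementary Nielsen transformations and conjugation. -/
theorem NielsenInvariant.of_pairGenerates {C : FreeGroup (Fin 2) → FreeGroup (Fin 2) → Prop}
    (hC : NielsenInvariant C) (hbase : C (of 0) (of 1)) {p q : FreeGroup (Fin 2)}
    (hg : PairGenerates p q) : C p q := by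
  induction hn : norm p + norm q using Nat.strong_induction_on generalizing p q with
  | _ n ih =>
    by_contra hpq
    have ih' : ∀ p' q', PairGenerates p' q' → norm p' + norm q' < norm p + norm q → C p' q' :=
      fun p' q' hg' hlt => ih _ (hn ▸ hlt) hg' rfl
    have key : ∀ x y, (x = p ∨ x = p⁻¹) → (y = q ∨ y = q⁻¹) →
        PairGenerates x y ∧ ¬ C x y ∧ norm x = norm p ∧ norm y = norm q := by
      rintro x y (rfl | rfl) (rfl | rfl)
      · exact ⟨hg, hpq, rfl, rfl⟩
      · exact ⟨hg.inv_right, fun h => hpq (hC.of_inv_right h), rfl, norm_inv_eq⟩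
      · exact ⟨hg.inv_left, fun h => hpq (hC.of_inv_left h), norm_inv_eq, rfl⟩
      · exact ⟨hg.inv_left.inv_right, fun h => hpq (hC.of_inv_left (hC.of_inv_right h)),
          norm_inv_eq, norm_inv_eq⟩
    have hle : ∀ x y, (x = p ∨ x = p⁻¹) → (y = q ∨ y = q⁻¹) →
        2 * gromovProduct x y ≤ norm p ∧ 2 * gromovProduct x y ≤ norm q := by
      intro x y hx hy
      obtain ⟨hg', hn', hxp, hyq⟩ := key x⁻¹ y (by rcases hx with rfl | rfl <;> simp) hy
      have h := hC.le_norm_of_minimal hg' (by rwa [hxp, hyq]) hn'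
      have h' := norm_inv_mul_add_two_mul_gromovProduct x y
      rw [norm_inv_eq] at hxp
      rw [norm_inv_eq] at h
      omega
    refine hpq (hC.of_isNielsenReduced hbase hg (isNielsenReduced_pair hg.left_ne_one
      hg.swap.left_ne_one hle ?_))
    intro x y hx hy
    obtain ⟨hg', hn', hxp, hyq⟩ := key x y hx hy
    constructor
    · intro h
      have h' := hle x y hx hy
      rw [← hxp] at h ⊢
      exact hC.two_mul_gromovProduct_ne hg' (by rwa [hxp, hyq]) hn' (by omega) h
    · intro h
      have h' := hle x y hx hy
      rw [gromovProduct_comm] at h h'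
      rw [← hyq] at h
      rw [gromovProduct_comm, ← hyq]
      refine hC.two_mul_gromovProduct_ne hg'.swap ?_ (fun h => hn' (hC.swap h)) (by omega) h
      rwa [hxp, hyq, add_comm]

/-- The turns `l m` that reduced words are allowed to take: all except `x₁ x₂⁻¹` and `x₂⁻¹ x₁`. -/
def AllowedTurn (l m : Fin 2 × Bool) : Prop :=
  (l.1 = m.1 → l.2 = m.2) ∧ ¬ (l = (0, true) ∧ m = (1, false)) ∧
    ¬ (l = (1, false) ∧ m = (0, true))

instance : DecidableRel AllowedTurn := fun _ _ => inferInstanceAs (Decidable (_ ∧ _ ∧ _))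

/-- The reduced word of `x` contains neither `x₁ x₂⁻¹` nor `x₂⁻¹ x₁`. -/
def IsCarried (x : FreeGroup (Fin 2)) : Prop := x.toWord.IsChain AllowedTurn

theorem isCarried_mk {L : List (Fin 2 × Bool)} (h : L.IsChain AllowedTurn) :
    IsCarried (mk L) := by
  have hr : IsReduced L := h.imp fun _ _ h => h.1
  rwa [IsCarried, toWord_mk, hr.reduce_eq]

/-- The endomorphism `x₁ ↦ x₁ x₂`, `x₂ ↦ x₂`. -/
def leftTwist : Monoid.End (FreeGroup (Fin 2)) := lift ![of 0 * of 1, of 1]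

/-- The endomorphism `x₁ ↦ x₁`, `x₂ ↦ x₂ x₁`. -/
def rightTwist : Monoid.End (FreeGroup (Fin 2)) := lift ![of 0, of 1 * of 0]

theorem mk_cons_not_cons {α : Type*} (x : α) (s : Bool) (L : List (α × Bool)) :
    mk ((x, s) :: (x, !s) :: L) = mk L :=
  Quot.sound Red.Step.cons_not

theorem exists_leftTwist_mk_eq {L : List (Fin 2 × Bool)} (h : L.IsChain AllowedTurn) :
    ∃ W, leftTwist (mk L) = mk W ∧ W.IsChain AllowedTurn ∧
      match (generalizing := false) L with
      | [] => W = []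
      | (0, true) :: _ => ∃ W', W = (0, true) :: W'
      | (1, true) :: _ => ∃ W', W = (1, true) :: W' ∨ W = (0, false) :: W'
      | (0, false) :: _ => ∃ W', W = (1, false) :: (0, false) :: W'
      | (1, false) :: _ => ∃ W', W = (1, false) :: W' := by
  induction L with
  | nil => exact ⟨[], by simp [← one_eq_mk], by simp, rfl⟩
  | cons l L ih =>
    obtain ⟨W, hW, hc, hh⟩ := ih h.tail
    have hl : leftTwist (mk (l :: L)) = leftTwist (mk [l]) * mk W := by
      rw [← hW, ← _root_.map_mul, mul_mk, List.singleton_append]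
    rw [hl]
    have e₁ : leftTwist (mk [(0, true)]) = mk [(0, true), (1, true)] := by decide
    have e₂ : leftTwist (mk [(0, false)]) = mk [(1, false), (0, false)] := by decide
    have e₃ : leftTwist (mk [(1, true)]) = mk [(1, true)] := by decide
    have e₄ : leftTwist (mk [(1, false)]) = mk [(1, false)] := by decide
    obtain ⟨l, s⟩ := l
    rcases L with _ | ⟨⟨m, t⟩, L⟩
    · dsimp only at hh
      subst hh
      fin_cases l <;> cases s <;> dsimp only [Fin.mk_zero, Fin.mk_one, Fin.zero_eta]
      · exact ⟨[(1, false), (0, false)], by rw [e₂, mul_mk]; rfl, by decide, [], rfl⟩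
      · exact ⟨[(0, true), (1, true)], by rw [e₁, mul_mk]; rfl, by decide, [(1, true)], rfl⟩
      · exact ⟨[(1, false)], by rw [e₄, mul_mk]; rfl, by decide, [], rfl⟩
      · exact ⟨[(1, true)], by rw [e₃, mul_mk]; rfl, by decide, [], .inl rfl⟩
    have hlm := (List.isChain_cons_cons.1 h).1
    clear ih h hl hW
    have a₁ : AllowedTurn (0, true) (0, true) := by decide
    have a₂ : AllowedTurn (0, true) (1, true) := by decide
    have a₃ : AllowedTurn (1, true) (1, true) := by decide
    have a₄ : AllowedTurn (1, true) (0, true) := by decide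
    have a₅ : AllowedTurn (1, true) (0, false) := by decide
    have a₆ : AllowedTurn (0, false) (0, false) := by decide
    have a₇ : AllowedTurn (0, false) (1, false) := by decide
    have a₈ : AllowedTurn (0, false) (1, true) := by decide
    have a₉ : AllowedTurn (1, false) (1, false) := by decide
    have a₀ : AllowedTurn (1, false) (0, false) := by decide
    fin_cases l <;> cases s <;> fin_cases m <;> cases t <;>
      first
      | exact absurd hlm (by decide)
      | (dsimp only [Fin.mk_zero, Fin.mk_one, Fin.zero_eta] at *
         obtain ⟨W, rfl | rfl⟩ := hh
         all_goals
           try rw [e₁]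
           try rw [e₂]
           try rw [e₃]
           try rw [e₄]
           rw [mul_mk]
           first
           | exact ⟨_, mk_cons_not_cons _ _ _, hc.tail, _, .inr rfl⟩
           | (refine ⟨_, rfl, ?_, _, rfl⟩
              simp [List.isChain_cons_cons, *])
           | (refine ⟨_, rfl, ?_, _, .inl rfl⟩
              simp [List.isChain_cons_cons, *]))

theorem exists_rightTwist_mk_eq {L : List (Fin 2 × Bool)} (h : L.IsChain AllowedTurn) :
    ∃ W, rightTwist (mk L) = mk W ∧ W.IsChain AllowedTurn ∧
      match (generalizing := false) L with
      | [] => W = []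
      | (0, true) :: _ => ∃ W', W = (0, true) :: W'
      | (1, true) :: _ => ∃ W', W = (1, true) :: W'
      | (0, false) :: _ => W = [(0, false)] ∨ (∃ W', W = (0, false) :: (0, false) :: W') ∨
          ∃ W', W = (0, false) :: (1, true) :: W'
      | (1, false) :: _ => ∃ W', W = (0, false) :: (1, false) :: W' := by
  induction L with
  | nil => exact ⟨[], by simp [← one_eq_mk], by simp, rfl⟩
  | cons l L ih =>
    obtain ⟨W, hW, hc, hh⟩ := ih h.tail
    have hl : rightTwist (mk (l :: L)) = rightTwist (mk [l]) * mk W := by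
      rw [← hW, ← _root_.map_mul, mul_mk, List.singleton_append]
    rw [hl]
    have e₁ : rightTwist (mk [(0, true)]) = mk [(0, true)] := by decide
    have e₂ : rightTwist (mk [(0, false)]) = mk [(0, false)] := by decide
    have e₃ : rightTwist (mk [(1, true)]) = mk [(1, true), (0, true)] := by decide
    have e₄ : rightTwist (mk [(1, false)]) = mk [(0, false), (1, false)] := by decide
    obtain ⟨l, s⟩ := l
    rcases L with _ | ⟨⟨m, t⟩, L⟩
    · dsimp only at hh
      subst hh
      fin_cases l <;> cases s <;> dsimp only [Fin.mk_zero, Fin.mk_one, Fin.zero_eta]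
      · exact ⟨[(0, false)], by rw [e₂, mul_mk]; rfl, by decide, .inl rfl⟩
      · exact ⟨[(0, true)], by rw [e₁, mul_mk]; rfl, by decide, [], rfl⟩
      · exact ⟨[(0, false), (1, false)], by rw [e₄, mul_mk]; rfl, by decide, [], rfl⟩
      · exact ⟨[(1, true), (0, true)], by rw [e₃, mul_mk]; rfl, by decide, [(0, true)], rfl⟩
    have hlm := (List.isChain_cons_cons.1 h).1
    clear ih h hl hW
    have a₁ : AllowedTurn (0, true) (0, true) := by decide
    have a₂ : AllowedTurn (0, true) (1, true) := by decide
    have a₃ : AllowedTurn (1, true) (1, true) := by decide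
    have a₄ : AllowedTurn (1, true) (0, true) := by decide
    have a₅ : AllowedTurn (1, true) (0, false) := by decide
    have a₆ : AllowedTurn (0, false) (0, false) := by decide
    have a₇ : AllowedTurn (0, false) (1, false) := by decide
    have a₈ : AllowedTurn (0, false) (1, true) := by decide
    have a₉ : AllowedTurn (1, false) (1, false) := by decide
    have a₀ : AllowedTurn (1, false) (0, false) := by decide
    fin_cases l <;> cases s <;> fin_cases m <;> cases t <;>
      first
      | exact absurd hlm (by decide)
      | (dsimp only [Fin.mk_zero, Fin.mk_one, Fin.zero_eta] at *
         first
         | have hh : _ ∨ _ ∨ _ := hh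
           obtain rfl | ⟨W, rfl⟩ | ⟨W, rfl⟩ := hh
         | obtain ⟨W, rfl⟩ := hh
         all_goals
           try rw [e₁]
           try rw [e₂]
           try rw [e₃]
           try rw [e₄]
           rw [mul_mk]
           first
           | (refine ⟨_, congrArg (FreeGroup.mk [(1, true)] * ·) (mk_cons_not_cons 0 true _), ?_,
                _, rfl⟩
              simp_all [List.isChain_cons_cons])
           | (refine ⟨_, rfl, ?_, _, rfl⟩
              simp [List.isChain_cons_cons, *])
           | (refine ⟨_, rfl, ?_, .inr (.inl ⟨_, rfl⟩)⟩
              simp [List.isChain_cons_cons, *])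
           | (refine ⟨_, rfl, ?_, .inr (.inr ⟨_, rfl⟩)⟩
              simp [List.isChain_cons_cons, *]))

theorem IsCarried.leftTwist {x : FreeGroup (Fin 2)} (h : IsCarried x) :
    IsCarried (FreeGroup.leftTwist x) := by
  obtain ⟨W, hW, hc, -⟩ := exists_leftTwist_mk_eq h
  rw [← mk_toWord (x := x), hW]
  exact isCarried_mk hc

theorem IsCarried.rightTwist {x : FreeGroup (Fin 2)} (h : IsCarried x) :
    IsCarried (FreeGroup.rightTwist x) := by
  obtain ⟨W, hW, hc, -⟩ := exists_rightTwist_mk_eq h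
  rw [← mk_toWord (x := x), hW]
  exact isCarried_mk hc

/-- The monoid of endomorphisms generated by `leftTwist` and `rightTwist`. -/
def twistMonoid : Submonoid (Monoid.End (FreeGroup (Fin 2))) :=
  Submonoid.closure {leftTwist, rightTwist}

theorem leftTwist_mem : leftTwist ∈ twistMonoid := Submonoid.subset_closure (by simp)

theorem rightTwist_mem : rightTwist ∈ twistMonoid := Submonoid.subset_closure (by simp)

theorem IsCarried.map {φ : Monoid.End (FreeGroup (Fin 2))} (hφ : φ ∈ twistMonoid) :
    ∀ {x : FreeGroup (Fin 2)}, IsCarried x → IsCarried (φ x) := by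
  induction hφ using Submonoid.closure_induction with
  | mem φ hφ =>
    obtain rfl | rfl := hφ
    · exact IsCarried.leftTwist
    · exact IsCarried.rightTwist
  | one => exact id
  | mul φ ψ _ _ hφ hψ => exact fun h => hφ (hψ h)

theorem eq_one_or_exists_of_mem_twistMonoid {φ : Monoid.End (FreeGroup (Fin 2))}
    (hφ : φ ∈ twistMonoid) :
    φ = 1 ∨ ∃ φ' ∈ twistMonoid, φ = φ' * leftTwist ∨ φ = φ' * rightTwist := by
  induction hφ using Submonoid.closure_induction_right with
  | one => exact .inl rfl
  | mul_right φ hφ ψ hψ _ =>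
    obtain rfl | rfl := hψ
    · exact .inr ⟨φ, hφ, .inl rfl⟩
    · exact .inr ⟨φ, hφ, .inr rfl⟩

/-- The automorphism `x₁ ↦ x₁`, `x₂ ↦ x₂⁻¹`. -/
def flipSnd : Monoid.End (FreeGroup (Fin 2)) := lift ![of 0, (of 1)⁻¹]

theorem flipSnd_mul_self : flipSnd * flipSnd = 1 := by
  apply ext_hom
  decide

/-- Up to conjugation, inverses and order, `(p, q)` is obtained from the standard basis by applying
an element of `twistMonoid` and possibly `flipSnd`. -/
def IsStandardPair (p q : FreeGroup (Fin 2)) : Prop :=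
  ∃ (g : FreeGroup (Fin 2)) (σ φ : Monoid.End (FreeGroup (Fin 2))) (i : Fin 2) (s t : Bool),
    (σ = 1 ∨ σ = flipSnd) ∧ φ ∈ twistMonoid ∧
      p = g * σ (φ (mk [(i, s)])) * g⁻¹ ∧ q = g * σ (φ (mk [(1 - i, t)])) * g⁻¹

namespace IsStandardPair

variable {σ φ ψ : Monoid.End (FreeGroup (Fin 2))} {P Q : FreeGroup (Fin 2)}

theorem of_conj (hσ : σ = 1 ∨ σ = flipSnd) (hφ : φ ∈ twistMonoid) (hψ : ψ ∈ twistMonoid)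
    (h : FreeGroup (Fin 2)) (i : Fin 2) (s t : Bool)
    (hP : P = h * ψ (mk [(i, s)]) * h⁻¹) (hQ : Q = h * ψ (mk [(1 - i, t)]) * h⁻¹) :
    IsStandardPair (σ (φ P)) (σ (φ Q)) := by
  refine ⟨σ (φ h), σ, φ * ψ, i, s, t, hσ, mul_mem hφ hψ, ?_, ?_⟩
  · rw [hP]
    simp only [_root_.map_mul, _root_.map_inv]
    rfl
  · rw [hQ]
    simp only [_root_.map_mul, _root_.map_inv]
    rfl

theorem of_flip_conj (hσ : σ = 1 ∨ σ = flipSnd) (hψ : ψ ∈ twistMonoid)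
    (h : FreeGroup (Fin 2)) (i : Fin 2) (s t : Bool)
    (hP : P = flipSnd (h * ψ (mk [(i, s)]) * h⁻¹))
    (hQ : Q = flipSnd (h * ψ (mk [(1 - i, t)]) * h⁻¹)) :
    IsStandardPair (σ P) (σ Q) := by
  rw [hP, hQ]
  have hσ' : σ * flipSnd = 1 ∨ σ * flipSnd = flipSnd := by
    obtain rfl | rfl := hσ
    · exact .inr (one_mul _)
    · exact .inl flipSnd_mul_self
  have H := of_conj (σ := σ * flipSnd) (φ := 1) hσ' (one_mem _) hψ h i s t rfl rfl
  exact H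

theorem mul_left_mk (hσ : σ = 1 ∨ σ = flipSnd) (hφ : φ ∈ twistMonoid) (i : Fin 2) (s t : Bool) :
    IsStandardPair (σ (φ (mk [(i, s)] * mk [(1 - i, t)]))) (σ (φ (mk [(1 - i, t)]))) := by
  by_cases hst : s = t
  · subst hst
    fin_cases i <;> cases s
    · exact of_conj hσ hφ leftTwist_mem (of 1) 0 false false (by decide) (by decide)
    · exact of_conj hσ hφ leftTwist_mem 1 0 true true (by decide) (by decide)
    · exact of_conj hσ hφ rightTwist_mem (of 0) 1 false false (by decide) (by decide)
    · exact of_conj hσ hφ rightTwist_mem 1 1 true true (by decide) (by decide)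
  obtain rfl : t = !s := by revert hst; cases s <;> cases t <;> decide
  obtain rfl | ⟨φ, hφ', rfl | rfl⟩ := eq_one_or_exists_of_mem_twistMonoid hφ
  · fin_cases i <;> cases s
    · exact of_flip_conj hσ leftTwist_mem (of 1) 0 false false (by decide) (by decide)
    · exact of_flip_conj hσ leftTwist_mem 1 0 true true (by decide) (by decide)
    · exact of_flip_conj hσ rightTwist_mem 1 1 true true (by decide) (by decide)
    · exact of_flip_conj hσ rightTwist_mem (of 0) 1 false false (by decide) (by decide)
  · change IsStandardPair (σ (φ (leftTwist _))) (σ (φ (leftTwist _)))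
    fin_cases i <;> cases s
    · exact of_conj hσ hφ' (one_mem _) (of 1)⁻¹ 0 false true (by decide) (by decide)
    · exact of_conj hσ hφ' (one_mem _) 1 0 true false (by decide) (by decide)
    · exact of_conj hσ hφ' rightTwist_mem (of 1)⁻¹ 0 true true (by decide) (by decide)
    · exact of_conj hσ hφ' rightTwist_mem (of 0) 0 false false (by decide) (by decide)
  · change IsStandardPair (σ (φ (rightTwist _))) (σ (φ (rightTwist _)))
    fin_cases i <;> cases s
    · exact of_conj hσ hφ' leftTwist_mem (of 0)⁻¹ 1 true true (by decide) (by decide)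
    · exact of_conj hσ hφ' leftTwist_mem (of 1) 1 false false (by decide) (by decide)
    · exact of_conj hσ hφ' (one_mem _) (of 0)⁻¹ 1 false true (by decide) (by decide)
    · exact of_conj hσ hφ' (one_mem _) 1 1 true false (by decide) (by decide)

end IsStandardPair

theorem isStandardPair_conj (g : FreeGroup (Fin 2)) {p q : FreeGroup (Fin 2)}
    (h : IsStandardPair p q) : IsStandardPair (g * p * g⁻¹) (g * q * g⁻¹) := by
  obtain ⟨k, σ, φ, i, s, t, hσ, hφ, rfl, rfl⟩ := h
  exact ⟨g * k, σ, φ, i, s, t, hσ, hφ, by group, by group⟩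

theorem nielsenInvariant_isStandardPair : NielsenInvariant IsStandardPair where
  conj := isStandardPair_conj
  swap := by
    rintro p q ⟨k, σ, φ, i, s, t, hσ, hφ, hp, hq⟩
    exact ⟨k, σ, φ, 1 - i, t, s, hσ, hφ, hq, by rwa [sub_sub_cancel]⟩
  inv_left := by
    rintro p q ⟨k, σ, φ, i, s, t, hσ, hφ, rfl, hq⟩
    refine ⟨k, σ, φ, i, !s, t, hσ, hφ, ?_, hq⟩
    have : (FreeGroup.mk [(i, !s)]) = (FreeGroup.mk [(i, s)])⁻¹ := rfl
    rw [this, _root_.map_inv, _root_.map_inv]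
    group
  mul_left := by
    rintro p q ⟨k, σ, φ, i, s, t, hσ, hφ, rfl, rfl⟩
    convert isStandardPair_conj k (IsStandardPair.mul_left_mk hσ hφ i s t) using 1
    rw [_root_.map_mul, _root_.map_mul]
    group

theorem PairGenerates.isStandardPair {p q : FreeGroup (Fin 2)} (h : PairGenerates p q) :
    IsStandardPair p q :=
  nielsenInvariant_isStandardPair.of_pairGenerates
    ⟨1, 1, 1, 0, true, true, .inl rfl, one_mem _, by decide, by decide⟩ h

section Infix

variable {α : Type*} [DecidableEq α]

theorem tail_toWord_suffix_mk_singleton_mul (l : α × Bool) (x : FreeGroup α) :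
    x.toWord.tail <:+ (mk [l] * x).toWord := by
  rw [← mk_toWord (x := x), mul_mk, List.singleton_append, toWord_mk, toWord_mk, reduce.cons,
    reduce_toWord]
  rcases x.toWord with _ | ⟨m, L⟩
  · simp
  · dsimp only
    split_ifs
    · exact List.suffix_rfl
    · exact (List.suffix_cons m L).trans (List.suffix_cons l _)

theorem drop_toWord_suffix_mk_mul (L : List (α × Bool)) (x : FreeGroup α) :
    x.toWord.drop L.length <:+ (mk L * x).toWord := by
  induction L with
  | nil => simp [← one_eq_mk]
  | cons l L ih =>
    rw [← List.singleton_append, ← mul_mk, mul_assoc]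
    refine List.IsSuffix.trans ?_ (tail_toWord_suffix_mk_singleton_mul l (mk L * x))
    have hl := ih.length_le
    rw [← List.drop_one]
    refine List.suffix_of_suffix_length_le (l₃ := (mk L * x).toWord) ?_ (List.drop_suffix _ _) ?_
    · refine List.IsSuffix.trans ?_ ih
      rw [List.length_append, List.length_singleton, add_comm, ← List.drop_drop]
      exact List.drop_suffix _ _
    · simp only [List.length_drop, List.length_append, List.length_singleton] at hl ⊢
      omega

theorem suffix_toWord_mul {g x : FreeGroup α} {A B : List (α × Bool)} (hx : x.toWord = A ++ B)
    (hA : g.toWord.length ≤ A.length) : B <:+ (g * x).toWord := by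
  have h := drop_toWord_suffix_mk_mul g.toWord x
  rw [mk_toWord, hx, List.drop_append_of_le_length hA] at h
  exact (List.suffix_append _ _).trans h

theorem prefix_toWord_mul {g x : FreeGroup α} {A B : List (α × Bool)} (hx : x.toWord = A ++ B)
    (hB : g.toWord.length ≤ B.length) : A <+: (x * g).toWord := by
  have h : invRev A <:+ (g⁻¹ * x⁻¹).toWord := by
    refine suffix_toWord_mul (A := invRev B) ?_ (by simpa using hB)
    rw [toWord_inv, hx, invRev_append]
  rw [← mul_inv_rev, toWord_inv] at h
  obtain ⟨E, hE⟩ := h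
  refine ⟨invRev E, ?_⟩
  rw [← invRev_invRev (L₁ := (x * g).toWord), ← hE, invRev_append, invRev_invRev]

theorem infix_toWord_mul_mul {g h x : FreeGroup α} {A B C : List (α × Bool)}
    (hx : x.toWord = A ++ B ++ C) (hA : g.toWord.length ≤ A.length)
    (hC : h.toWord.length ≤ C.length) : B <:+: (g * x * h).toWord := by
  rw [List.append_assoc] at hx
  obtain ⟨D, hD⟩ := suffix_toWord_mul hx hA
  rw [← List.append_assoc] at hD
  exact (List.suffix_append _ _).isInfix.trans (prefix_toWord_mul hD.symm hC).isInfix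

theorem exists_infix_toWord_conj_pow {u : FreeGroup α} (hu : IsCyclicallyReduced u.toWord)
    (g : FreeGroup α) : ∃ n : ℕ, u.toWord <:+: (g * u ^ n * g⁻¹).toWord := by
  rcases eq_or_ne u 1 with rfl | h1
  · exact ⟨0, by simp⟩
  have hpos : 0 < u.toWord.length := List.length_pos_iff.2 (by simpa using h1)
  set N := g.toWord.length with hN
  refine ⟨N + 1 + N, infix_toWord_mul_mul (A := (List.replicate N u.toWord).flatten)
    (C := (List.replicate N u.toWord).flatten) ?_ ?_ ?_⟩
  · rw [toWord_pow, (hu.flatten_replicate _).1.reduce_eq, List.replicate_add, List.replicate_add]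
    simp
  · simpa using Nat.le_mul_of_pos_right N hpos
  · simpa using Nat.le_mul_of_pos_right N hpos

end Infix

theorem toWord_flipSnd (x : FreeGroup (Fin 2)) :
    (flipSnd x).toWord = x.toWord.map fun l => (l.1, l.2 == (l.1 == 0)) := by
  have h : ∀ L : List (Fin 2 × Bool),
      flipSnd (mk L) = mk (L.map fun l => (l.1, l.2 == (l.1 == 0))) := by
    intro L
    induction L with
    | nil => exact _root_.map_one flipSnd
    | cons l L ih =>
      rw [List.map_cons, ← List.singleton_append, ← mul_mk, _root_.map_mul, ih,
        ← List.singleton_append (l := List.map _ L), ← mul_mk]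
      congr 1
      revert l
      decide
  have hr : IsReduced (x.toWord.map fun l => (l.1, l.2 == (l.1 == 0))) := by
    rw [IsReduced, List.isChain_map]
    refine isReduced_toWord.imp ?_
    decide
  rw [← mk_toWord (x := x), h, toWord_mk, toWord_mk, reduce_toWord, hr.reduce_eq]

theorem isCarried_or_isCarried_inv {i : Fin 2} {s t : Bool} {L : List (Fin 2 × Bool)}
    (h : ∀ l ∈ L, l = (i, s) ∨ l = (1 - i, t)) : IsCarried (mk L) ∨ IsCarried (mk L)⁻¹ := by
  have key : ∀ (i : Fin 2) (s t : Bool),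
      (∀ l ∈ [(i, s), (1 - i, t)], ∀ m ∈ [(i, s), (1 - i, t)], AllowedTurn l m) ∨
      ∀ l ∈ [(i, s), (1 - i, t)], ∀ m ∈ [(i, s), (1 - i, t)],
        AllowedTurn (m.1, !m.2) (l.1, !l.2) := by
    intro i s t
    fin_cases i <;> cases s <;> cases t <;> simp [AllowedTurn]
  have h' : ∀ l ∈ L, l ∈ [(i, s), (1 - i, t)] := by simpa using h
  refine (key i s t).imp (fun key => isCarried_mk ?_) fun key => ?_
  · exact (List.pairwise_of_forall_mem_list fun l hl m hm => key l (h' l hl) m (h' m hm)).isChain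
  · rw [inv_mk]
    apply isCarried_mk
    rw [invRev, List.isChain_reverse, List.isChain_map]
    exact (List.pairwise_of_forall_mem_list fun l hl m hm => key l (h' l hl) m (h' m hm)).isChain

theorem not_infix_of_isCarried {σ : Monoid.End (FreeGroup (Fin 2))} (hσ : σ = 1 ∨ σ = flipSnd)
    {y : FreeGroup (Fin 2)} (hy : IsCarried y ∨ IsCarried y⁻¹) :
    ¬ [(0, true), (1, true), (0, false), (1, false), (0, true)] <:+: (σ y).toWord := by
  intro hv
  have key : ∀ v : List (Fin 2 × Bool), ¬ v.IsChain AllowedTurn →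
      ¬ (invRev v).IsChain AllowedTurn → ¬ v <:+: y.toWord := by
    intro v h₁ h₂ hv
    rcases hy with hy | hy
    · exact h₁ (hy.infix hv)
    · rw [IsCarried, toWord_inv] at hy
      exact h₂ (hy.infix (List.reverse_infix.2 (hv.map _)))
  obtain rfl | rfl := hσ
  · exact key _ (by decide) (by decide) hv
  · have hv' := hv.map fun l : Fin 2 × Bool => (l.1, l.2 == (l.1 == 0))
    rw [← toWord_flipSnd, show flipSnd (flipSnd y) = y from
      DFunLike.congr_fun flipSnd_mul_self y] at hv'
    exact key _ (by decide) (by decide) hv'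

theorem exists_mk_letters_eq {p : FreeGroup (Fin 2) →* FreeGroup (Fin 2)} {i : Fin 2}
    {s t : Bool} (h₀ : p (of 0) = mk [(i, s)]) (h₁ : p (of 1) = mk [(1 - i, t)])
    {L : List (Fin 2 × Bool)} (hL : ∀ l ∈ L, l.2 = true) :
    ∃ L', p (mk L) = mk L' ∧ ∀ l ∈ L', l = (i, s) ∨ l = (1 - i, t) := by
  induction L with
  | nil => exact ⟨[], _root_.map_one p, by simp⟩
  | cons l L ih =>
    obtain ⟨L', hL', h⟩ := ih fun m hm => hL m (List.mem_cons_of_mem _ hm)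
    obtain ⟨m, hm, hm'⟩ : ∃ m, p (mk [l]) = mk [m] ∧ (m = (i, s) ∨ m = (1 - i, t)) := by
      obtain ⟨j, b⟩ := l
      obtain rfl : b = true := hL _ List.mem_cons_self
      fin_cases j
      · exact ⟨_, h₀, .inl rfl⟩
      · exact ⟨_, h₁, .inr rfl⟩
    refine ⟨m :: L', ?_, List.forall_mem_cons.2 ⟨hm', h⟩⟩
    rw [← List.singleton_append, ← mul_mk, _root_.map_mul, hm, hL', mul_mk,
      List.singleton_append]

theorem PairGenerates.of_mulEquiv (θ : FreeGroup (Fin 2) ≃* FreeGroup (Fin 2)) :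
    PairGenerates (θ (of 0)) (θ (of 1)) := by
  intro H h₀ h₁
  have hc : H.comap θ.toMonoidHom = ⊤ := by
    rw [eq_top_iff, ← closure_range_of, Subgroup.closure_le]
    rintro _ ⟨j, rfl⟩
    fin_cases j
    · exact h₀
    · exact h₁
  rw [Subgroup.eq_top_iff'] at hc ⊢
  intro x
  simpa using hc (θ.symm x)

theorem exists_conj_mulEquiv_eq (θ : FreeGroup (Fin 2) ≃* FreeGroup (Fin 2)) :
    ∃ (g : FreeGroup (Fin 2)) (σ : Monoid.End (FreeGroup (Fin 2))), (σ = 1 ∨ σ = flipSnd) ∧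
      ∀ L : List (Fin 2 × Bool), (∀ l ∈ L, l.2 = true) →
        ∃ y, (IsCarried y ∨ IsCarried y⁻¹) ∧ g * θ (mk L) * g⁻¹ = σ y := by
  obtain ⟨g, σ, φ, i, s, t, hσ, hφ, hp, hq⟩ := (PairGenerates.of_mulEquiv θ).isStandardPair
  refine ⟨g⁻¹, σ, hσ, fun L hL => ?_⟩
  set p : FreeGroup (Fin 2) →* FreeGroup (Fin 2) := lift ![mk [(i, s)], mk [(1 - i, t)]] with hpdef
  have h₀ : p (of 0) = mk [(i, s)] := by simp [hpdef]
  have h₁ : p (of 1) = mk [(1 - i, t)] := by simp [hpdef]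
  have hθ : (MulAut.conj g⁻¹).toMonoidHom.comp θ.toMonoidHom =
      (σ : FreeGroup (Fin 2) →* FreeGroup (Fin 2)).comp
        ((φ : FreeGroup (Fin 2) →* FreeGroup (Fin 2)).comp p) := by
    apply ext_hom
    intro j
    fin_cases j
    · change g⁻¹ * θ (of 0) * g⁻¹⁻¹ = σ (φ (p (of 0)))
      rw [hp, h₀]
      group
    · change g⁻¹ * θ (of 1) * g⁻¹⁻¹ = σ (φ (p (of 1)))
      rw [hq, h₁]
      group
  obtain ⟨L', hL', h⟩ := exists_mk_letters_eq h₀ h₁ hL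
  refine ⟨φ (mk L'), ?_, ?_⟩
  · rw [← _root_.map_inv]
    exact (isCarried_or_isCarried_inv h).imp (IsCarried.map hφ) (IsCarried.map hφ)
  · rw [← hL']
    exact DFunLike.congr_fun hθ (mk L)

end FreeGroup

theorem CyclicallyReduced.isCyclicallyReduced {r : ℕ} {u : FG r} (hu : CyclicallyReduced u) :
    FreeGroup.IsCyclicallyReduced u.toWord := by
  refine ⟨FreeGroup.isReduced_toWord, fun a ha b hb hab => ?_⟩
  have h := hu b hb a ha
  obtain ⟨i, s⟩ := a
  obtain ⟨j, t⟩ := b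
  obtain rfl : i = j := hab
  revert h
  cases s <;> cases t <;> simp

/-- If `u ∈ F_2` is cyclically reduced and the reduced word of
`x_1 x_2 x_1⁻¹ x_2⁻¹ x_1` occurs as an infix of the reduced word of `u`, then `u` is
not potentially positive. -/
theorem not_potentially_positive_of_blocking_infix (u : FG 2)
    (hcr : CyclicallyReduced u)
    (hinf : (FreeGroup.of 0 * FreeGroup.of 1 * (FreeGroup.of 0)⁻¹ * (FreeGroup.of 1)⁻¹ *
      FreeGroup.of 0 : FG 2).toWord <:+: u.toWord) :
    ¬ ∃ α : FG 2 ≃* FG 2, Positive (α u) := by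
  rintro ⟨α, hα⟩
  obtain ⟨g, σ, hσ, H⟩ := FreeGroup.exists_conj_mulEquiv_eq α.symm
  obtain ⟨n, hn⟩ := FreeGroup.exists_infix_toWord_conj_pow hcr.isCyclicallyReduced g
  obtain ⟨y, hy, hgy⟩ := H (List.replicate n (α u).toWord).flatten fun l hl => by
    obtain ⟨L, hL, hl⟩ := List.mem_flatten.1 hl
    rw [List.eq_of_mem_replicate hL] at hl
    exact hα l hl
  rw [← FreeGroup.pow_mk, FreeGroup.mk_toWord, map_pow, MulEquiv.symm_apply_apply] at hgy
  rw [hgy] at hn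
  refine FreeGroup.not_infix_of_isCarried hσ hy (List.IsInfix.trans ?_ hn)
  convert hinf
  decide
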